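/- Assume |ξ| ≠ 1/(2βη²γ), and let E, B ∈ ℂ³ satisfy ξ · E = 0 and ξ · B = 0. Set s = (λ₋(ξ) − λ₊(ξ))/λ₋(ξ), e = (E + (i/(γ λ₋(ξ))) ξ × B)/s and b = (B + (i/(γ λ₋(ξ))) ξ × E)/s. Then ξ · e = 0, ξ · b = 0, and (E, B) = (−(i/(γ λ₋(ξ))) ξ × b, b) + (e, −(i/(γ λ₋(ξ))) ξ × e), where the first summand is an eigenvector (or zero) of Â(ξ) for the eigenvalue λ₊(ξ) and the second summand is an eigenvector (or zero) of Â(ξ) for the eigenvalue λ₋(ξ). -/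

import Mathlib

noncomputable section

open Complex

/-- ℂ³ with the Hermitian (Euclidean) norm. -/
abbrev V3 : Type := EuclideanSpace ℂ (Fin 3)
/-- ℝ³ with the Euclidean norm. -/
abbrev R3 : Type := EuclideanSpace ℝ (Fin 3)

/-- The cross product, extended ℂ-bilinearly to ℂ³. -/
def cross (a b : V3) : V3 :=
  (WithLp.equiv 2 (Fin 3 → ℂ)).symm
    ![a 1 * b 2 - a 2 * b 1, a 2 * b 0 - a 0 * b 2, a 0 * b 1 - a 1 * b 0]

/-- The dot product, extended ℂ-bilinearly to ℂ³. -/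
def dotc (a b : V3) : ℂ := a 0 * b 0 + a 1 * b 1 + a 2 * b 2

/-- The coercion of a real vector to a complex vector. -/
def toC (ξ : R3) : V3 := (WithLp.equiv 2 (Fin 3 → ℂ)).symm fun j => ((ξ j : ℝ) : ℂ)

/-- The Fourier-side Maxwell operator Â(ξ). -/
def Ahat (β η γ : ℝ) (ξ : R3) (v : V3 × V3) : V3 × V3 :=
  (-(1 / ((β : ℂ) * (η : ℂ) ^ 2 * (γ : ℂ) ^ 2)) • v.1 + (I / (γ : ℂ)) • cross (toC ξ) v.2,
   (-(I / (γ : ℂ))) • cross (toC ξ) v.1)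

/-- The eigenvalue λ₀ = −1/(βη²γ²). -/
def lam0 (β η γ : ℝ) : ℂ := -(1 / ((β : ℂ) * (η : ℂ) ^ 2 * (γ : ℂ) ^ 2))

/-- δ(ξ) = √(1 − 4β²η⁴γ²|ξ|²) if |ξ| ≤ 1/(2βη²γ), and i√(4β²η⁴γ²|ξ|² − 1) otherwise. -/
def deltaF (β η γ : ℝ) (ξ : R3) : ℂ :=
  if ‖ξ‖ ≤ 1 / (2 * β * η ^ 2 * γ) then
    ((Real.sqrt (1 - 4 * β ^ 2 * η ^ 4 * γ ^ 2 * ‖ξ‖ ^ 2) : ℝ) : ℂ)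
  else I * ((Real.sqrt (4 * β ^ 2 * η ^ 4 * γ ^ 2 * ‖ξ‖ ^ 2 - 1) : ℝ) : ℂ)

/-- λ₊(ξ) = (−1 + δ(ξ))/(2βη²γ²). -/
def lamP (β η γ : ℝ) (ξ : R3) : ℂ :=
  (-1 + deltaF β η γ ξ) / (2 * (β : ℂ) * (η : ℂ) ^ 2 * (γ : ℂ) ^ 2)

/-- λ₋(ξ) = (−1 − δ(ξ))/(2βη²γ²). -/
def lamM (β η γ : ℝ) (ξ : R3) : ℂ :=
  (-1 - deltaF β η γ ξ) / (2 * (β : ℂ) * (η : ℂ) ^ 2 * (γ : ℂ) ^ 2)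

lemma cross_add (a b c : V3) : cross a (b + c) = cross a b + cross a c := by
  ext i
  fin_cases i <;> simp [cross] <;> ring

lemma cross_smul (r : ℂ) (a b : V3) : cross a (r • b) = r • cross a b := by
  ext i
  fin_cases i <;> simp [cross] <;> ring

lemma dotc_add (a b c : V3) : dotc a (b + c) = dotc a b + dotc a c := by
  simp [dotc]
  ring

lemma dotc_smul (r : ℂ) (a b : V3) : dotc a (r • b) = r * dotc a b := by
  simp [dotc]
  ring

lemma dotc_cross_self (a b : V3) : dotc a (cross a b) = 0 := by
  simp [dotc, cross]
  ring

/-- The expansion `a × (a × b) = (a · b) a − (a · a) b`, for `b` orthogonal to `a`. -/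
lemma cross_cross_of_dotc_eq_zero (a b : V3) (h : dotc a b = 0) :
    cross a (cross a b) = (-dotc a a) • b := by
  unfold dotc at h
  ext i
  fin_cases i <;> simp [cross, dotc]
  · linear_combination a 0 * h
  · linear_combination a 1 * h
  · linear_combination a 2 * h

lemma dotc_toC_self (ξ : R3) : dotc (toC ξ) (toC ξ) = ((‖ξ‖ ^ 2 : ℝ) : ℂ) := by
  rw [EuclideanSpace.real_norm_sq_eq]
  simp [dotc, toC, Fin.sum_univ_three]
  ring

lemma deltaF_sq {β η γ : ℝ} (hβ : 0 < β) (hη : 0 < η) (hγ : 0 < γ) (ξ : R3) :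
    deltaF β η γ ξ ^ 2 = ((1 - 4 * β ^ 2 * η ^ 4 * γ ^ 2 * ‖ξ‖ ^ 2 : ℝ) : ℂ) := by
  have hD : 0 < 2 * β * η ^ 2 * γ := by positivity
  have hx : 0 ≤ ‖ξ‖ * (2 * β * η ^ 2 * γ) := by positivity
  unfold deltaF
  split_ifs with hle
  · rw [le_div_iff₀ hD] at hle
    rw [← Complex.ofReal_pow, Real.sq_sqrt (by nlinarith)]
  · rw [not_le, div_lt_iff₀ hD] at hle
    rw [mul_pow, ← Complex.ofReal_pow, Real.sq_sqrt (by nlinarith), I_sq]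
    push_cast
    ring

lemma lamP_add_lamM (β η γ : ℝ) (ξ : R3) : lamP β η γ ξ + lamM β η γ ξ = lam0 β η γ := by
  simp only [lamP, lamM, lam0]
  ring

lemma lamP_mul_lamM {β η γ : ℝ} (hβ : 0 < β) (hη : 0 < η) (hγ : 0 < γ) (ξ : R3) :
    (γ : ℂ) ^ 2 * (lamP β η γ ξ * lamM β η γ ξ) = dotc (toC ξ) (toC ξ) := by
  have hδ := deltaF_sq hβ hη hγ ξ
  have hβ' : (β : ℂ) ≠ 0 := by exact_mod_cast hβ.ne'
  have hη' : (η : ℂ) ≠ 0 := by exact_mod_cast hη.ne'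
  have hγ' : (γ : ℂ) ≠ 0 := by exact_mod_cast hγ.ne'
  rw [dotc_toC_self]
  push_cast at hδ ⊢
  simp only [lamP, lamM]
  field_simp
  linear_combination -hδ

lemma lamM_ne_zero {β η γ : ℝ} (hβ : 0 < β) (hη : 0 < η) (hγ : 0 < γ) {ξ : R3} (hξ : ξ ≠ 0) :
    lamM β η γ ξ ≠ 0 := by
  intro h0
  have hprod := lamP_mul_lamM hβ hη hγ ξ
  rw [h0, mul_zero, mul_zero, dotc_toC_self] at hprod
  have hn : ‖ξ‖ ^ 2 = 0 := by exact_mod_cast hprod.symm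
  exact hξ (by simpa using hn)

lemma lamM_sub_lamP_ne_zero {β η γ : ℝ} (hβ : 0 < β) (hη : 0 < η) (hγ : 0 < γ) {ξ : R3}
    (h : ‖ξ‖ ≠ 1 / (2 * β * η ^ 2 * γ)) : lamM β η γ ξ - lamP β η γ ξ ≠ 0 := by
  intro h0
  have hβ' : (β : ℂ) ≠ 0 := by exact_mod_cast hβ.ne'
  have hη' : (η : ℂ) ≠ 0 := by exact_mod_cast hη.ne'
  have hγ' : (γ : ℂ) ≠ 0 := by exact_mod_cast hγ.ne'
  have hD : 0 < 2 * β * η ^ 2 * γ := by positivity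
  have hδ0 : deltaF β η γ ξ = 0 := by
    simp only [lamP, lamM] at h0
    field_simp at h0
    linear_combination (-1 / 2) * h0
  have hδ := deltaF_sq hβ hη hγ ξ
  rw [hδ0, zero_pow two_ne_zero] at hδ
  have hn : 1 - 4 * β ^ 2 * η ^ 4 * γ ^ 2 * ‖ξ‖ ^ 2 = 0 := by exact_mod_cast hδ.symm
  apply h
  rw [eq_div_iff hD.ne']
  have hx : 0 ≤ ‖ξ‖ * (2 * β * η ^ 2 * γ) := by positivity
  exact (pow_left_inj₀ hx zero_le_one two_ne_zero).mp (by linear_combination -hn)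

/-- `Ahat` written with the eigenvalue `lam0`. -/
lemma Ahat_eq (β η γ : ℝ) (ξ : R3) (v : V3 × V3) :
    Ahat β η γ ξ v = (lam0 β η γ • v.1 + (I / (γ : ℂ)) • cross (toC ξ) v.2,
      (-(I / (γ : ℂ))) • cross (toC ξ) v.1) := rfl

/-- for |ξ| ≠ 1/(2βη²γ) and E, B ∈ ℂ³ with ξ·E = ξ·B = 0, setting
s = (λ₋ − λ₊)/λ₋, e = (E + (i/(γλ₋)) ξ × B)/s and b = (B + (i/(γλ₋)) ξ × E)/s, one has
ξ·e = 0, ξ·b = 0, (E, B) = (−(i/(γλ₋)) ξ × b, b) + (e, −(i/(γλ₋)) ξ × e), the first summand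
being an eigenvector (or zero) of Â(ξ) for λ₊(ξ) and the second one for λ₋(ξ). -/
theorem spectral_decomposition (β η γ : ℝ) (hβ : 0 < β) (hη : 0 < η) (hγ : 0 < γ)
    (ξ : R3) (hξ : ξ ≠ 0) (h : ‖ξ‖ ≠ 1 / (2 * β * η ^ 2 * γ))
    (E B : V3) (hE : dotc (toC ξ) E = 0) (hB : dotc (toC ξ) B = 0)
    (s : ℂ) (e b : V3)
    (hs : s = (lamM β η γ ξ - lamP β η γ ξ) / lamM β η γ ξ)
    (he : e = s⁻¹ • (E + (I / ((γ : ℂ) * lamM β η γ ξ)) • cross (toC ξ) B))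
    (hb : b = s⁻¹ • (B + (I / ((γ : ℂ) * lamM β η γ ξ)) • cross (toC ξ) E)) :
    dotc (toC ξ) e = 0 ∧ dotc (toC ξ) b = 0 ∧
    (E, B) = ((-(I / ((γ : ℂ) * lamM β η γ ξ))) • cross (toC ξ) b, b)
      + (e, (-(I / ((γ : ℂ) * lamM β η γ ξ))) • cross (toC ξ) e) ∧
    Ahat β η γ ξ ((-(I / ((γ : ℂ) * lamM β η γ ξ))) • cross (toC ξ) b, b)
      = lamP β η γ ξ • ((-(I / ((γ : ℂ) * lamM β η γ ξ))) • cross (toC ξ) b, b) ∧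
    Ahat β η γ ξ (e, (-(I / ((γ : ℂ) * lamM β η γ ξ))) • cross (toC ξ) e)
      = lamM β η γ ξ • (e, (-(I / ((γ : ℂ) * lamM β η γ ξ))) • cross (toC ξ) e) := by
  have hγ' : (γ : ℂ) ≠ 0 := by exact_mod_cast hγ.ne'
  have hM := lamM_ne_zero hβ hη hγ hξ
  have hMP := lamM_sub_lamP_ne_zero hβ hη hγ h
  have hprod := lamP_mul_lamM hβ hη hγ ξ
  have hs0 : s ≠ 0 := hs ▸ div_ne_zero hMP hM
  have hde : dotc (toC ξ) e = 0 := by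
    simp [he, dotc_add, dotc_smul, dotc_cross_self, hE]
  have hdb : dotc (toC ξ) b = 0 := by
    simp [hb, dotc_add, dotc_smul, dotc_cross_self, hB]
  simp only [Ahat_eq, ← lamP_add_lamM β η γ ξ]
  generalize lamM β η γ ξ = m at *
  generalize lamP β η γ ξ = p at *
  obtain ⟨k, hk⟩ : ∃ k, k = I / ((γ : ℂ) * m) := ⟨_, rfl⟩
  rw [← hk] at he hb ⊢
  have hIγ : I / (γ : ℂ) = k * m := by
    rw [hk]
    field_simp
  have hk2 : k ^ 2 * dotc (toC ξ) (toC ξ) * m = -p := by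
    rw [← hprod, hk]
    field_simp
    rw [I_sq]
    ring
  have hs1 : s⁻¹ * (1 + k ^ 2 * dotc (toC ξ) (toC ξ)) = 1 := by
    rw [inv_mul_eq_iff_eq_mul₀ hs0, hs, mul_one, eq_div_iff hM]
    linear_combination hk2
  rw [hIγ]
  refine ⟨hde, hdb, ?_, ?_, ?_⟩
  · simp only [Prod.mk_add_mk, Prod.mk.injEq]
    constructor
    · rw [he, hb, cross_smul, cross_add, cross_smul, cross_cross_of_dotc_eq_zero _ _ hE]
      linear_combination (norm := module) (-hs1) • E
    · rw [he, hb, cross_smul, cross_add, cross_smul, cross_cross_of_dotc_eq_zero _ _ hB]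
      linear_combination (norm := module) (-hs1) • B
  · simp only [Prod.smul_mk, Prod.mk.injEq, cross_smul, cross_cross_of_dotc_eq_zero _ _ hdb]
    constructor
    · module
    · linear_combination (norm := module) (-hk2) • b
  · simp only [Prod.smul_mk, Prod.mk.injEq, cross_smul, cross_cross_of_dotc_eq_zero _ _ hde]
    constructor
    · linear_combination (norm := module) hk2 • e
    · module
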